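/- Let (X, A_X) be a finite network and let β > 0. Define u^{R/R_max}(x,x';β) = u^{R}(x,x') if u^{R}(x,x') ≤ β, and u^{R/R_max}(x,x';β) = max(β, u^{NR}(x,x')) if u^{R}(x,x') > β. Then u^{R/R_max}(·,·;β) satisfies the strong triangle inequality: for all x, x', x'' ∈ X, u^{R/R_max}(x,x';β) ≤ max(u^{R/R_max}(x,x'';β), u^{R/R_max}(x'',x';β)); together with its symmetry and identity properties this makes it a valid ultrametric on X. -/

import Mathlib

noncomputable section

/-- Cost of a chain (a finite ordered list of nodes): the maximum dissimilarity
encountered over consecutive pairs (0 for chains with fewer than two nodes). -/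
def chainCost {X : Type*} (A : X → X → ℝ) : List X → ℝ
  | [] => 0
  | [_] => 0
  | a :: b :: rest => max (A a b) (chainCost A (b :: rest))

/-- The set of costs of chains from `x` to `x'`. -/
def chainCosts {X : Type*} (A : X → X → ℝ) (x x' : X) : Set ℝ :=
  { c | ∃ l : List X, l.head? = some x ∧ l.getLast? = some x' ∧ chainCost A l = c }

/-- Directed minimum chain cost ũ*(x,x'). -/
def minChainCost {X : Type*} (A : X → X → ℝ) (x x' : X) : ℝ :=
  sInf (chainCosts A x x')

/-- The reciprocal ultrametric u^R. -/
def uR {X : Type*} (A : X → X → ℝ) (x x' : X) : ℝ :=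
  minChainCost (fun a b => max (A a b) (A b a)) x x'

/-- The nonreciprocal ultrametric u^NR. -/
def uNR {X : Type*} (A : X → X → ℝ) (x x' : X) : ℝ :=
  max (minChainCost A x x') (minChainCost A x' x)

/-- The set of costs of chains from `x` to `x'` having at most `t` nodes. -/
def boundedChainCosts {X : Type*} (A : X → X → ℝ) (t : ℕ) (x x' : X) : Set ℝ :=
  { c | ∃ l : List X, l.head? = some x ∧ l.getLast? = some x' ∧ l.length ≤ t ∧
      chainCost A l = c }

/-- A^{SR(t)}(x,x'): minimum cost over chains from `x` to `x'` with at most `t` nodes. -/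
def ASR {X : Type*} (A : X → X → ℝ) (t : ℕ) (x x' : X) : ℝ :=
  sInf (boundedChainCosts A t x x')

/-- The semi-reciprocal ultrametric u^{SR(t)}. -/
def uSR {X : Type*} (A : X → X → ℝ) (t : ℕ) (x x' : X) : ℝ :=
  minChainCost (fun a b => max (ASR A t a b) (ASR A t b a)) x x'

/-- The grafted function u^{R/R_max}(·,·;β). -/
def uRRmax {X : Type*} (A : X → X → ℝ) (β : ℝ) (x x' : X) : ℝ :=
  if uR A x x' ≤ β then uR A x x' else max β (uNR A x x')

theorem chainCost_nonneg {X : Type*} {A : X → X → ℝ} (hA : ∀ a b, 0 ≤ A a b) :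
    ∀ l : List X, 0 ≤ chainCost A l
  | [] => le_rfl
  | [_] => le_rfl
  | a :: b :: _ => le_max_of_le_left (hA a b)

theorem minChainCost_nonneg {X : Type*} {A : X → X → ℝ} (hA : ∀ a b, 0 ≤ A a b) (x y : X) :
    0 ≤ minChainCost A x y := by
  apply Real.sInf_nonneg
  rintro _ ⟨l, -, -, rfl⟩
  exact chainCost_nonneg hA l

theorem reflTransGen_of_chainCost_lt {X : Type*} {A : X → X → ℝ} {c : ℝ} {y : X} (l : List X) :
    ∀ x : X, l.head? = some x → l.getLast? = some y → chainCost A l < c →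
      Relation.ReflTransGen (fun a b => A a b < c) x y := by
  induction l with
  | nil => simp
  | cons a l ih =>
    intro x hx hy hl
    obtain rfl : a = x := by simpa using hx
    cases l with
    | nil =>
      obtain rfl : a = y := by simpa using hy
      exact .refl
    | cons b l =>
      have hcost := max_lt_iff.1 (show max (A a b) (chainCost A (b :: l)) < c from hl)
      exact .head hcost.1 (ih b rfl (by simpa using hy) hcost.2)

theorem exists_chainCost_lt_of_reflTransGen {X : Type*} {A : X → X → ℝ} {c : ℝ} (hc : 0 < c)
    {x y : X} (h : Relation.ReflTransGen (fun a b => A a b < c) x y) :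
    ∃ l : List X, l.head? = some x ∧ l.getLast? = some y ∧ chainCost A l < c := by
  induction h using Relation.ReflTransGen.head_induction_on with
  | refl => exact ⟨[y], rfl, rfl, hc⟩
  | @head a b hab _ ih =>
    obtain ⟨l, hb, hy, hl⟩ := ih
    cases l with
    | nil => simp at hb
    | cons b' l =>
      obtain rfl : b' = b := by simpa using hb
      exact ⟨a :: b' :: l, rfl, by simpa using hy, max_lt hab hl⟩

theorem chainCosts_nonempty {X : Type*} (A : X → X → ℝ) (x y : X) : (chainCosts A x y).Nonempty :=
  ⟨_, [x, y], rfl, rfl, rfl⟩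

theorem minChainCost_lt_iff {X : Type*} {A : X → X → ℝ} (hA : ∀ a b, 0 ≤ A a b) {c : ℝ}
    (hc : 0 < c) {x y : X} :
    minChainCost A x y < c ↔ Relation.ReflTransGen (fun a b => A a b < c) x y := by
  have hbdd : BddBelow (chainCosts A x y) := by
    refine ⟨0, ?_⟩
    rintro _ ⟨l, -, -, rfl⟩
    exact chainCost_nonneg hA l
  rw [minChainCost, csInf_lt_iff hbdd (chainCosts_nonempty A x y)]
  constructor
  · rintro ⟨_, ⟨l, hx, hy, rfl⟩, hl⟩
    exact reflTransGen_of_chainCost_lt l x hx hy hl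
  · intro h
    obtain ⟨l, hx, hy, hl⟩ := exists_chainCost_lt_of_reflTransGen hc h
    exact ⟨_, ⟨l, hx, hy, rfl⟩, hl⟩

theorem minChainCost_self {X : Type*} {A : X → X → ℝ} (hA : ∀ a b, 0 ≤ A a b) (x : X) :
    minChainCost A x x = 0 :=
  le_antisymm (le_of_forall_gt fun _ hc => (minChainCost_lt_iff hA hc).2 .refl)
    (minChainCost_nonneg hA x x)

theorem minChainCost_le_max {X : Type*} {A : X → X → ℝ} (hA : ∀ a b, 0 ≤ A a b) (x y z : X) :
    minChainCost A x y ≤ max (minChainCost A x z) (minChainCost A z y) := by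
  refine le_of_forall_gt fun c h => ?_
  obtain ⟨hxz, hzy⟩ := max_lt_iff.1 h
  have hc := (minChainCost_nonneg hA x z).trans_lt hxz
  rw [minChainCost_lt_iff hA hc] at *
  exact hxz.trans hzy

theorem minChainCost_mono {X : Type*} {A B : X → X → ℝ} (hA : ∀ a b, 0 ≤ A a b)
    (hAB : ∀ a b, A a b ≤ B a b) (x y : X) : minChainCost A x y ≤ minChainCost B x y := by
  have hB a b := (hA a b).trans (hAB a b)
  refine le_of_forall_gt fun c h => ?_
  have hc := (minChainCost_nonneg hB x y).trans_lt h
  rw [minChainCost_lt_iff hB hc] at h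
  exact (minChainCost_lt_iff hA hc).2 (Relation.ReflTransGen.mono (fun a b => (hAB a b).trans_lt) _ _ h)

theorem minChainCost_swap_le {X : Type*} {A : X → X → ℝ} (hA : ∀ a b, 0 ≤ A a b)
    (hsymm : ∀ a b, A a b = A b a) (x y : X) : minChainCost A x y ≤ minChainCost A y x := by
  refine le_of_forall_gt fun c h => ?_
  have hc := (minChainCost_nonneg hA y x).trans_lt h
  rw [minChainCost_lt_iff hA hc] at *
  have hs : (fun a b => A a b < c) = Function.swap (fun a b => A a b < c) := by
    funext a b
    simp only [Function.swap, hsymm a b]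
  rw [hs]
  exact h.swap

theorem minChainCost_pos {X : Type*} [Finite X] {A : X → X → ℝ} (hA : ∀ a b, 0 ≤ A a b)
    (hid : ∀ a b, A a b = 0 → a = b) {x y : X} (hxy : x ≠ y) : 0 < minChainCost A x y := by
  obtain ⟨⟨⟨a, b⟩, hab⟩, hmin⟩ :=
    haveI : Nonempty {p : X × X // p.1 ≠ p.2} := ⟨⟨(x, y), hxy⟩⟩
    Finite.exists_min fun p : {p : X × X // p.1 ≠ p.2} => A p.1.1 p.1.2
  have hpos : 0 < A a b := (hA a b).lt_of_ne fun h => hab (hid a b h.symm)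
  refine hpos.trans_le (not_lt.1 fun h => hxy ?_)
  rw [minChainCost_lt_iff hA hpos] at h
  induction h with
  | refl => rfl
  | @tail u v _ huv ih =>
    obtain rfl : u = v := by_contra fun hne => (hmin ⟨(u, v), hne⟩).not_gt huv
    exact ih hxy

theorem uNR_le_uR {X : Type*} {A : X → X → ℝ} (hA : ∀ a b, 0 ≤ A a b) (x y : X) :
    uNR A x y ≤ uR A x y := by
  have hM : ∀ a b, 0 ≤ max (A a b) (A b a) := fun a b => le_max_of_le_left (hA a b)
  exact max_le (minChainCost_mono hA (fun _ _ => le_max_left _ _) x y)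
    ((minChainCost_mono hA (fun _ _ => le_max_left _ _) y x).trans
      (minChainCost_swap_le hM (fun _ _ => max_comm _ _) y x))

theorem uNR_le_max {X : Type*} {A : X → X → ℝ} (hA : ∀ a b, 0 ≤ A a b) (x y z : X) :
    uNR A x y ≤ max (uNR A x z) (uNR A z y) := by
  have h₁ := minChainCost_le_max hA x y z
  have h₂ := minChainCost_le_max hA y x z
  simp only [uNR]
  grind

/-- the grafted function u^{R/R_max}(·,·;β) is a valid ultrametric:
it is symmetric, vanishes exactly on the diagonal, and satisfies the strong
triangle inequality. -/
theorem grafting_RRmax_is_ultrametric {X : Type*} [Fintype X]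
    (A : X → X → ℝ)
    (hnonneg : ∀ x x' : X, 0 ≤ A x x')
    (hid : ∀ x x' : X, A x x' = 0 ↔ x = x')
    (β : ℝ) (hβ : 0 < β) :
    (∀ x x' : X, uRRmax A β x x' = uRRmax A β x' x) ∧
    (∀ x x' : X, uRRmax A β x x' = 0 ↔ x = x') ∧
    (∀ x x' x'' : X,
      uRRmax A β x x' ≤ max (uRRmax A β x x'') (uRRmax A β x'' x')) := by
  have hM : ∀ a b, 0 ≤ max (A a b) (A b a) := fun a b => le_max_of_le_left (hnonneg a b)
  have hcomm : ∀ x y, uR A x y = uR A y x := fun x y =>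
    le_antisymm (minChainCost_swap_le hM (fun _ _ => max_comm _ _) x y)
      (minChainCost_swap_le hM (fun _ _ => max_comm _ _) y x)
  refine ⟨fun x y => ?_, fun x y => ⟨fun h => ?_, ?_⟩, fun x y z => ?_⟩
  · simp only [uRRmax, hcomm x y, uNR, max_comm (minChainCost A x y)]
  · by_contra hxy
    have hpos : 0 < uR A x y := minChainCost_pos hM (fun a b hab => (hid a b).1
      (le_antisymm ((le_max_left _ _).trans hab.le) (hnonneg a b))) hxy
    have hmax : 0 < max β (uNR A x y) := lt_max_of_lt_left hβ
    unfold uRRmax at h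
    split_ifs at h
    · exact hpos.ne' h
    · exact hmax.ne' h
  · rintro rfl
    have hself : uR A x x = 0 := minChainCost_self hM x
    simp [uRRmax, hself, hβ.le]
  · have hR : uR A x y ≤ max (uR A x z) (uR A z y) := minChainCost_le_max hM x y z
    have hNR := uNR_le_max hnonneg x y z
    have h₁ := uNR_le_uR hnonneg x z
    have h₂ := uNR_le_uR hnonneg z y
    unfold uRRmax
    grind
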